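/- Let W(x) = (x−1)^4 (x^2 + Sx + S^2/4)(x^2 + Mx + N) with real numbers S, M, N satisfying S > 0 and N ≥ M^2/4. Then W does not define the sign pattern (+,+,−,−,−,+,−,+,+) and does not define the sign pattern (+,+,+,−,−,+,−,+,+). -/

import Mathlib

open Polynomial

/-- A degree-8 real polynomial `P` defines the sign pattern `σ = (σ_0, …, σ_8)`
(with entries `1` for `+`, `-1` for `−`) if for each `j` the coefficient of
`x^(8-j)` is nonzero and has sign `σ_j`. -/
def definesSignPattern (P : Polynomial ℝ) (σ : Fin 9 → ℝ) : Prop :=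
  ∀ j : Fin 9, Real.sign (P.coeff (8 - (j : ℕ))) = σ j

/-- Three of the inequalities on the coefficients of
`(x - 1)^4 (x + s)^2 (x^2 + M x + N)`, those for `x^7`, `x^4` and `x^1`, are already
incompatible with `M^2 / 4 ≤ N`. -/
lemma not_coeff_seven_four_one_signs {s M N : ℝ} (hs : 0 < s) (hN : M ^ 2 / 4 ≤ N)
    (h₇ : 0 < M + 2 * s - 4)
    (h₄ : 6 * s ^ 2 - 8 * s + 1 + M * (-4 * s ^ 2 + 12 * s - 4)
      + N * (s ^ 2 - 8 * s + 6) < 0)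
    (h₁ : 0 < s * (M * s + N * (2 - 4 * s))) : False := by
  replace h₁ : 0 < M * s + N * (2 - 4 * s) := pos_of_mul_pos_right h₁ hs.le
  rcases le_or_gt s (4 / 5) with hs' | hs'
  · have hq : 0 ≤ s ^ 2 - 8 * s + 6 := by nlinarith
    have h := mul_le_mul_of_nonneg_right hN hq
    have hd : 0 ≤ -s ^ 3 + 6 * s ^ 2 - 10 * s + 8 := by nlinarith [pow_pos hs 2, pow_pos hs 3]
    nlinarith [mul_nonneg h₇.le hd, mul_nonneg (sq_nonneg (M + 2 * s - 4)) hq,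
      sq_nonneg (s ^ 2 - 2 * s + 2)]
  have hN0 : 0 ≤ N := (by positivity : 0 ≤ M ^ 2 / 4).trans hN
  have hM : 0 < M := by
    by_contra! hM
    nlinarith [mul_nonneg hN0 (by linarith : 0 ≤ 4 * s - 2), mul_nonneg (neg_nonneg.2 hM) hs.le]
  have hM' : M * (2 * s - 1) < 2 * s := by
    by_contra! hM'
    nlinarith [mul_le_mul_of_nonneg_right hN (by linarith : 0 ≤ 4 * s - 2),
      mul_le_mul_of_nonneg_left hM' hM.le]
  rcases le_or_gt 0 (s ^ 2 - 8 * s + 6) with hq | hq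
  · rcases le_or_gt s 1 with hs1 | hs1
    · have h := mul_le_mul_of_nonneg_right hN hq
      have hd : 0 ≤ -s ^ 3 + 6 * s ^ 2 - 10 * s + 8 := by nlinarith [pow_pos hs 2, pow_pos hs 3]
      nlinarith [mul_nonneg h₇.le hd, mul_nonneg (sq_nonneg (M + 2 * s - 4)) hq,
        sq_nonneg (s ^ 2 - 2 * s + 2)]
    · have hs7 : 7 < s := by nlinarith
      have hM2 : M < 4 / 3 := by nlinarith
      nlinarith [mul_nonneg hN0 hq,
        mul_pos (sub_pos.2 hM2) (by nlinarith : 0 < 4 * s ^ 2 - 12 * s + 4)]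
  · have key : (4 * s - 2) * (6 * s ^ 2 - 8 * s + 1)
        + M * (-15 * s ^ 3 + 48 * s ^ 2 - 34 * s + 8) < 0 := by
      nlinarith [mul_pos h₁ (neg_pos.2 hq), mul_pos (neg_pos.2 h₄) (by linarith : 0 < 4 * s - 2)]
    rcases le_or_gt 0 (-15 * s ^ 3 + 48 * s ^ 2 - 34 * s + 8) with hL | hL
    · rcases le_or_gt s 2 with hs2 | hs2
      · have := mul_nonneg h₇.le hL
        have : 0 < (4 * s - 2) * (6 * s ^ 2 - 8 * s + 1)
          + (4 - 2 * s) * (-15 * s ^ 3 + 48 * s ^ 2 - 34 * s + 8) := by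
          nlinarith [sq_nonneg (5 * s ^ 2 - 11 * s + 5), pow_pos hs 2]
        nlinarith
      · nlinarith [mul_nonneg hM.le hL,
          mul_pos (by linarith : 0 < 4 * s - 2) (by nlinarith : 0 < 6 * s ^ 2 - 8 * s + 1)]
    · have hs2 : 2 < s := by
        by_contra! hs2
        nlinarith [mul_nonneg (sub_nonneg.2 hs2) (sub_pos.2 hs').le,
          mul_nonneg (mul_nonneg (sub_nonneg.2 hs2) (sub_pos.2 hs').le) hs.le]
      have := mul_pos (sub_pos.2 hM') (neg_pos.2 hL)
      have : 0 < 2 * (2 * s - 1) ^ 2 * (6 * s ^ 2 - 8 * s + 1)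
          + 2 * s * (-15 * s ^ 3 + 48 * s ^ 2 - 34 * s + 8) := by
        nlinarith [sq_nonneg (3 * s ^ 2 - 4 / 3 * s), sq_nonneg (2 * s - 1), pow_pos hs 2]
      nlinarith

lemma coeff_quartic_mul_quadratics (S M N : ℝ) (P : ℝ[X])
    (hP : P = (X - 1) ^ 4 * (X ^ 2 + C S * X + C (S ^ 2 / 4)) * (X ^ 2 + C M * X + C N)) :
    P.coeff 7 = M + S - 4 ∧
    P.coeff 4 = 6 * (S ^ 2 / 4) - 4 * S + 1 + M * (-4 * (S ^ 2 / 4) + 6 * S - 4)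
      + N * (S ^ 2 / 4 - 4 * S + 6) ∧
    P.coeff 1 = M * (S ^ 2 / 4) + N * (S - 4 * (S ^ 2 / 4)) := by
  generalize S ^ 2 / 4 = T at *
  have h : P = X ^ 8 + C (M + S - 4) * X ^ 7 + C (T - 4 * S + 6 + M * (S - 4) + N) * X ^ 6
      + C (-4 * T + 6 * S - 4 + M * (T - 4 * S + 6) + N * (S - 4)) * X ^ 5
      + C (6 * T - 4 * S + 1 + M * (-4 * T + 6 * S - 4) + N * (T - 4 * S + 6)) * X ^ 4
      + C (-4 * T + S + M * (6 * T - 4 * S + 1) + N * (-4 * T + 6 * S - 4)) * X ^ 3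
      + C (T + M * (-4 * T + S) + N * (6 * T - 4 * S + 1)) * X ^ 2
      + C (M * T + N * (S - 4 * T)) * X + C (N * T) := by
    rw [hP]
    simp only [map_add, map_sub, map_mul, map_neg, map_ofNat, map_one]
    ring
  rw [h]
  refine ⟨?_, ?_, ?_⟩ <;>
    simp [-map_add, -map_sub, -map_mul, -map_neg, coeff_C, coeff_X_pow]

lemma pos_of_sign_eq_one {r : ℝ} (h : Real.sign r = 1) : 0 < r := by
  rcases lt_trichotomy r 0 with hr | hr | hr
  · norm_num [Real.sign_of_neg hr] at h
  · norm_num [hr] at h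
  · exact hr

lemma neg_of_sign_eq_neg_one {r : ℝ} (h : Real.sign r = -1) : r < 0 := by
  rcases lt_trichotomy r 0 with hr | hr | hr
  · exact hr
  · norm_num [hr] at h
  · norm_num [Real.sign_of_pos hr] at h

lemma not_definesSignPattern_of_coeff_signs {S M N : ℝ} (hS : 0 < S) (hN : M ^ 2 / 4 ≤ N)
    {σ : Fin 9 → ℝ} (h₇ : σ 1 = 1) (h₄ : σ 4 = -1) (h₁ : σ 7 = 1) :
    ¬ definesSignPattern
        ((X - 1) ^ 4 * (X ^ 2 + C S * X + C (S ^ 2 / 4)) *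
          (X ^ 2 + C M * X + C N)) σ := by
  intro h
  obtain ⟨e₇, e₄, e₁⟩ := coeff_quartic_mul_quadratics S M N _ rfl
  have g₇ := pos_of_sign_eq_one ((h 1).trans h₇)
  have g₄ := neg_of_sign_eq_neg_one ((h 4).trans h₄)
  have g₁ := pos_of_sign_eq_one ((h 7).trans h₁)
  change 0 < Polynomial.coeff _ 7 at g₇
  change Polynomial.coeff _ 4 < 0 at g₄
  change 0 < Polynomial.coeff _ 1 at g₁
  rw [e₇] at g₇
  rw [e₄] at g₄
  rw [e₁] at g₁
  refine not_coeff_seven_four_one_signs (half_pos hS) hN ?_ ?_ ?_ <;> linarith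

/-- For `S > 0` and `N ≥ M²/4`, the polynomial
`W = (x−1)⁴ (x² + Sx + S²/4)(x² + Mx + N)` defines neither the sign pattern
(+,+,−,−,−,+,−,+,+) nor the sign pattern (+,+,+,−,−,+,−,+,+). -/
theorem stmt19 (S M N : ℝ) (hS : 0 < S) (hN : M ^ 2 / 4 ≤ N) :
    ¬ definesSignPattern
        ((X - 1) ^ 4 * (X ^ 2 + C S * X + C (S ^ 2 / 4)) *
          (X ^ 2 + C M * X + C N)) ![1, 1, -1, -1, -1, 1, -1, 1, 1] ∧
    ¬ definesSignPattern
        ((X - 1) ^ 4 * (X ^ 2 + C S * X + C (S ^ 2 / 4)) *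
          (X ^ 2 + C M * X + C N)) ![1, 1, 1, -1, -1, 1, -1, 1, 1] := by
  exact ⟨not_definesSignPattern_of_coeff_signs hS hN rfl rfl rfl,
    not_definesSignPattern_of_coeff_signs hS hN rfl rfl rfl⟩
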